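/- arXiv:0901.4092 — 2 statements merged into one kernel-verified Lean document; each statement's English description precedes it below -/
import Mathlib

section
/- If X and Y are uniformly homeomorphic Banach spaces (there is a bijection φ : X → Y with φ and φ⁻¹ uniformly continuous), then X and Y are locally equivalent: there is a constant C > 0 such that every finite-dimensional subspace E of X satisfies d(E,F) ≤ C for some finite-dimensional subspace F of Y, and vice versa. -/
open MeasureTheory Filter Topology Metric Set
open scoped NNReal

theorem ribe_coarse {X Y : Type*} [NormedAddCommGroup X] [NormedSpace ℝ X]
    [NormedAddCommGroup Y] (f : X → Y) (hf : UniformContinuous f) :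
    ∃ K > (0 : ℝ), ∀ x y, ‖f x - f y‖ ≤ K * ‖x - y‖ + K := by
  obtain ⟨δ, hδ, H⟩ := Metric.uniformContinuous_iff.1 hf 1 one_pos
  have step : ∀ n : ℕ, ∀ x y : X, ‖x - y‖ ≤ n * (δ / 2) → ‖f x - f y‖ ≤ n := by
    intro n
    induction n with
    | zero =>
      intro x y h
      have : x = y := by
        have : ‖x - y‖ ≤ 0 := by simpa using h
        exact sub_eq_zero.1 (norm_le_zero_iff.1 this)
      simp [this]
    | succ n ih =>
      intro x y h
      push_cast at h ⊢
      have hn : (0 : ℝ) < (n : ℝ) + 1 := by positivity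
      set z : X := x + ((n : ℝ) + 1)⁻¹ • (y - x) with hz
      have h1 : ‖x - z‖ ≤ δ / 2 := by
        have : x - z = ((n : ℝ) + 1)⁻¹ • (x - y) := by
          rw [hz, smul_sub, smul_sub]; abel
        rw [this, norm_smul, Real.norm_of_nonneg (by positivity), inv_mul_le_iff₀ hn]
        exact h
      have h2 : ‖z - y‖ ≤ n * (δ / 2) := by
        have : z - y = ((n : ℝ) / (n + 1)) • (x - y) := by
          have e : ((n : ℝ) / (n + 1)) = 1 - ((n : ℝ) + 1)⁻¹ := by field_simp; ring
          rw [hz, e, sub_smul, one_smul, smul_sub, smul_sub]; abel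
        rw [this, norm_smul, Real.norm_of_nonneg (by positivity), div_mul_eq_mul_div,
          div_le_iff₀ hn]
        calc (n : ℝ) * ‖x - y‖ ≤ n * ((n + 1) * (δ / 2)) := by gcongr
          _ = _ := by ring
      have h3 : ‖f x - f z‖ < 1 := by
        rw [← dist_eq_norm]; apply H; rw [dist_eq_norm]; linarith
      calc ‖f x - f y‖ = ‖(f x - f z) + (f z - f y)‖ := by congr 1; abel
        _ ≤ ‖f x - f z‖ + ‖f z - f y‖ := norm_add_le _ _
        _ ≤ _ := by linarith [ih z y h2]
  refine ⟨2 / δ + 1, by positivity, fun x y => ?_⟩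
  have h1 := step ⌈‖x - y‖ / (δ / 2)⌉₊ x y (by
    rw [← div_le_iff₀ (by positivity)]; exact Nat.le_ceil _)
  have h2 := (Nat.ceil_lt_add_one (a := ‖x - y‖ / (δ / 2)) (by positivity)).le
  have e : ‖x - y‖ / (δ / 2) = 2 / δ * ‖x - y‖ := by field_simp
  have : 0 < 2 / δ := by positivity
  nlinarith [norm_nonneg (x - y)]

theorem ribe_one_dim {ι : Type*} [Countable ι] (h : ι → ℝ → ℝ) (L : ℝ≥0)
    (hL : ∀ i, LipschitzWith L (h i)) (c c' : ℝ) (hcc : c < c')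
    (H : ∀ s t, s < t → ∃ i, c' * (t - s) ≤ h i t - h i s) :
    ∀ᵐ s : ℝ, ∃ i, c ≤ deriv (h i) s := by
  have : Nonempty ι := ⟨(H 0 1 one_pos).choose⟩
  set w : ℝ → ℝ := fun s => ⨆ i, deriv (h i) s with hw
  have hd : ∀ i s, |deriv (h i) s| ≤ L := fun i s => by
    have := norm_deriv_le_of_lipschitz (hL i) (x₀ := s)
    simpa using this
  have hbdd : ∀ s, BddAbove (range fun i => deriv (h i) s) := fun s =>
    ⟨L, by rintro _ ⟨i, rfl⟩; exact (abs_le.1 (hd i s)).2⟩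
  have hwm : Measurable w := Measurable.iSup fun i => measurable_deriv _
  have hwb : ∀ s, ‖w s‖ ≤ L := fun s => by
    rw [Real.norm_eq_abs, abs_le]
    refine ⟨?_, ciSup_le fun i => (abs_le.1 (hd i s)).2⟩
    obtain ⟨i⟩ := ‹Nonempty ι›
    exact (abs_le.1 (hd i s)).1.trans (le_ciSup (hbdd s) i)
  have hwi : LocallyIntegrable w volume := by
    have : MemLp w ⊤ volume := memLp_top_of_bound hwm.aestronglyMeasurable L
      (Eventually.of_forall hwb)
    exact this.locallyIntegrable le_top
  have hint : ∀ s t, IntervalIntegrable w volume s t := fun s t =>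
    (hwi.integrableOn_isCompact isCompact_uIcc).intervalIntegrable
  have key : ∀ s t, s < t → c' * (t - s) ≤ ∫ x in s..t, w x := by
    intro s t hst
    obtain ⟨i, hi⟩ := H s t hst
    have hac : AbsolutelyContinuousOnInterval (h i) s t :=
      ((hL i).lipschitzOnWith).absolutelyContinuousOnInterval
    rw [← hac.integral_deriv_eq_sub] at hi
    refine hi.trans (intervalIntegral.integral_mono_on hst.le hac.intervalIntegrable_deriv
      (hint s t) fun x _ => le_ciSup (hbdd x) i)
  filter_upwards [LocallyIntegrable.ae_hasDerivAt_integral hwi] with s hs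
  have hs0 := hs 0
  have hge : c' ≤ w s := by
    have := hs0.tendsto_slope_zero_right
    refine ge_of_tendsto this ?_
    filter_upwards [self_mem_nhdsWithin] with t (ht : 0 < t)
    rw [intervalIntegral.integral_interval_sub_left (hint _ _) (hint _ _),
      smul_eq_mul, le_inv_mul_iff₀ ht]
    have := key s (s + t) (by linarith)
    linarith
  obtain ⟨i, hi⟩ := exists_lt_of_lt_ciSup (lt_of_lt_of_le hcc hge)
  exact ⟨i, hi.le⟩

theorem ribe_ae_lineDeriv {ι E : Type*} [Countable ι] [NormedAddCommGroup E] [NormedSpace ℝ E]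
    [FiniteDimensional ℝ E] [MeasurableSpace E] [BorelSpace E] (μ : Measure E)
    [μ.IsAddHaarMeasure]
    (F : ι → E → ℝ) (L : ℝ≥0) (hL : ∀ i, LipschitzWith L (F i)) (c c' : ℝ) (hcc : c < c')
    (u : E) (H : ∀ x, ∀ t : ℝ, 0 < t → ∃ i, c' * t ≤ F i (x + t • u) - F i x) :
    ∀ᵐ x ∂μ, ∃ i, c ≤ lineDeriv ℝ (F i) x u := by
  let M : ℝ →L[ℝ] E := ContinuousLinearMap.smulRight (1 : ℝ →L[ℝ] ℝ) u
  have hmeas : MeasurableSet {x | ∃ i, c ≤ lineDeriv ℝ (F i) x u} := by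
    have : {x | ∃ i, c ≤ lineDeriv ℝ (F i) x u} = ⋃ i, {x | c ≤ lineDeriv ℝ (F i) x u} := by
      ext; simp
    rw [this]
    exact MeasurableSet.iUnion fun i =>
      measurableSet_le measurable_const (measurable_lineDeriv (hL i).continuous)
  suffices A : ∀ p : E, ∀ᵐ s : ℝ, p + M s ∈ {x | ∃ i, c ≤ lineDeriv ℝ (F i) x u} from
    ae_mem_of_ae_add_linearMap_mem M.toLinearMap volume μ hmeas A
  intro p
  have h1 := ribe_one_dim (fun i s => F i (p + M s)) (L * ‖M‖₊)
    (fun i => by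
      have := (hL i).comp ((LipschitzWith.const p).add M.lipschitz)
      rw [zero_add] at this
      exact this) c c' hcc
    (by
      intro s t hst
      obtain ⟨i, hi⟩ := H (p + M s) (t - s) (by linarith)
      refine ⟨i, ?_⟩
      have : p + M s + (t - s) • u = p + M t := by
        simp [M, sub_smul]
      rwa [this] at hi)
  filter_upwards [h1] with s ⟨i, hi⟩
  refine ⟨i, ?_⟩
  have : lineDeriv ℝ (F i) (p + M s) u = deriv (fun s => F i (p + M s)) s := by
    rw [lineDeriv]
    have := deriv_comp_const_add (f := fun s => F i (p + M s)) s 0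
    rw [add_zero] at this
    rw [← this]
    congr 1
    ext t
    simp [M, add_smul, add_assoc]
  rw [this]; exact hi

theorem ribe_unif {E : Type*} [NormedAddCommGroup E] (U : Filter ℕ) (h : ℕ → E → ℝ)
    (H : E → ℝ) (a : ℕ → ℝ) (K : ℝ) (hK : 0 < K) (ha : Tendsto a U (𝓝 0))
    (hh : ∀ n x y, |h n x - h n y| ≤ K * ‖x - y‖ + K * a n)
    (hH : ∀ x y, |H x - H y| ≤ K * ‖x - y‖)
    (hlim : ∀ x, Tendsto (fun n => h n x) U (𝓝 (H x)))
    (S : Set E) (hS : IsCompact S) (ε : ℝ) (hε : 0 < ε) :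
    ∀ᶠ n in U, ∀ z ∈ S, |h n z - H z| ≤ ε := by
  obtain ⟨P, -, hPf, hP⟩ := hS.finite_cover_balls (e := ε / (4 * K)) (by positivity)
  have h1 : ∀ᶠ n in U, ∀ p ∈ P, |h n p - H p| < ε / 4 := by
    refine (Filter.eventually_all_finite hPf).2 fun p _ => ?_
    have := Metric.tendsto_nhds.1 (hlim p) (ε / 4) (by positivity)
    simpa [Real.dist_eq] using this
  have h2 : ∀ᶠ n in U, a n < ε / (4 * K) := ha.eventually_lt_const (by positivity)
  filter_upwards [h1, h2] with n hn1 hn2 z hz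
  obtain ⟨p, hp, hzp⟩ := by simpa using hP hz
  rw [dist_eq_norm] at hzp
  have e1 := hh n z p
  have e2 := hH z p
  have e3 := hn1 p hp
  have e4 : K * ‖z - p‖ ≤ ε / 4 := by
    calc K * ‖z - p‖ ≤ K * (ε / (4 * K)) := by gcongr
      _ = _ := by field_simp
  have e5 : K * a n ≤ ε / 4 := by
    calc K * a n ≤ K * (ε / (4 * K)) := by gcongr
      _ = _ := by field_simp
  rw [abs_le] at *
  rw [abs_lt] at e3
  constructor <;> linarith [e1.1, e1.2, e2.1, e2.2, e3.1, e3.2]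

theorem ribe_averaging (E Y : Type*) [NormedAddCommGroup E] [NormedSpace ℝ E]
    [FiniteDimensional ℝ E] [NormedAddCommGroup Y] [NormedSpace ℝ Y] [CompleteSpace Y]
    (K : ℝ) (hK : 0 < K) (η : ℝ) (hη : 0 < η) :
    ∃ δ > (0 : ℝ), ∀ f : E → Y, Continuous f → f 0 = 0 →
      (∀ x y, ‖f x - f y‖ ≤ K * ‖x - y‖ + δ) →
      ∃ T : E →L[ℝ] Y, (∀ u, ‖T u‖ ≤ (K + η) * ‖u‖) ∧
        ∀ (g : StrongDual ℝ Y) (l : StrongDual ℝ E),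
          (∀ z, ‖z‖ ≤ 2 → |g (f z) - l z| ≤ δ) → ∀ u, |g (T u) - l u| ≤ η * ‖u‖ := by
  borelize E
  let μ : Measure E := Measure.addHaar
  let b : ContDiffBump (0 : E) := ⟨1, 2, one_pos, one_lt_two⟩
  set ψ : E → ℝ := b.normed μ with hψ
  have ψsm : ContDiff ℝ 2 ψ := b.contDiff_normed (n := 2)
  have ψc : HasCompactSupport ψ := b.hasCompactSupport_normed
  have ψts : tsupport ψ = closedBall 0 2 := b.tsupport_normed_eq
  have ψ0 : ∀ z, 2 < ‖z‖ → ψ z = 0 := fun z hz => by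
    apply image_eq_zero_of_notMem_tsupport
    rw [ψts]; simpa using hz
  have dψ0 : ∀ z, 2 < ‖z‖ → fderiv ℝ ψ z = 0 := fun z hz => by
    apply image_eq_zero_of_notMem_tsupport
    intro h
    have := tsupport_fderiv_subset ℝ h
    rw [ψts] at this
    simp at this; linarith
  have ψnn : ∀ z, 0 ≤ ψ z := b.nonneg_normed
  have ψi : ∫ z, ψ z ∂μ = 1 := b.integral_normed
  have ψint : Integrable ψ μ := b.integrable_normed
  have dψcont : Continuous (fderiv ℝ ψ) := ψsm.continuous_fderiv (by norm_num)
  have dψc : HasCompactSupport (fderiv ℝ ψ) := ψc.fderiv ℝ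
  have ψdiff : Differentiable ℝ ψ := ψsm.differentiable (by norm_num)
  have dψint : Integrable (fun z => ‖fderiv ℝ ψ z‖) μ :=
    (dψcont.integrable_of_hasCompactSupport dψc).norm
  obtain ⟨D, hD⟩ : ∃ D, LipschitzWith D (fderiv ℝ ψ) :=
    ContDiff.lipschitzWith_of_hasCompactSupport (𝕂 := ℝ) (n := 1) dψc
      (ψsm.fderiv_right (by norm_num)) (by norm_num)
  set M : ℝ := ∫ z, ‖fderiv ℝ ψ z‖ ∂μ with hM
  have hM0 : 0 ≤ M := integral_nonneg fun _ => norm_nonneg _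
  -- the second order estimate
  have taylor : ∀ z v : E, |ψ (z - v) - ψ z + fderiv ℝ ψ z v| ≤ D * ‖v‖ * ‖v‖ := by
    intro z v
    have := (convex_closedBall z ‖v‖).norm_image_sub_le_of_norm_fderiv_le' (𝕜 := ℝ) (f := ψ)
      (φ := fderiv ℝ ψ z) (C := D * ‖v‖) (x := z) (y := z - v)
      (fun x _ => ψdiff x)
      (fun x hx => by
        refine (hD.norm_sub_le x z).trans ?_
        gcongr
        simpa [dist_eq_norm] using hx) (by simp) (by simp)
    simpa [sub_eq_add_neg, add_assoc] using this
  -- parameters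
  set V : ℝ := μ.real (closedBall (0 : E) 3) with hV
  have hV0 : 0 ≤ V := measureReal_nonneg
  set Q : ℝ := D * (3 * K + 1) * V with hQ
  have hQ0 : 0 ≤ Q := by positivity
  set h : ℝ := min 1 (η / 2 / (Q + 1)) with hh
  have hpos : 0 < h := by positivity
  have h1 : h ≤ 1 := min_le_left _ _
  have hQh : Q * h ≤ η / 2 := by
    calc Q * h ≤ (Q + 1) * (η / 2 / (Q + 1)) := by
          gcongr
          · linarith
          · exact min_le_right _ _
      _ = η / 2 := by field_simp
  set δ : ℝ := min (min 1 (h * η / 2)) (η / (M + 1)) with hδ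
  have δpos : 0 < δ := by positivity
  have δ1 : δ ≤ 1 := (min_le_left _ _).trans (min_le_left _ _)
  have δ2 : δ ≤ h * η / 2 := (min_le_left _ _).trans (min_le_right _ _)
  have δ3 : δ * M ≤ η := by
    calc δ * M ≤ (η / (M + 1)) * (M + 1) := by
          gcongr
          · exact min_le_right _ _
          · linarith
      _ = η := by field_simp
  refine ⟨δ, δpos, fun f fc f0 fb => ?_⟩
  have int1 : ∀ u, Integrable (fun z => fderiv ℝ ψ z u • f z) μ := fun u => by
    apply Continuous.integrable_of_hasCompactSupport
    · exact (dψcont.clm_apply continuous_const).smul fc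
    · exact (dψc.comp_left (g := fun L : StrongDual ℝ E => L u) rfl).smul_right
  let T₀ : E →ₗ[ℝ] Y :=
    { toFun := fun u => -∫ z, fderiv ℝ ψ z u • f z ∂μ
      map_add' := fun u v => by
        simp only [map_add, add_smul]
        rw [integral_add (int1 u) (int1 v), neg_add]
      map_smul' := fun c u => by
        simp only [map_smul, smul_eq_mul, mul_smul, RingHom.id_apply]
        rw [integral_smul, smul_neg] }
  let T : E →L[ℝ] Y := LinearMap.toContinuousLinearMap T₀
  have hT : ∀ u, T u = -∫ z, fderiv ℝ ψ z u • f z ∂μ := fun u => rfl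
  refine ⟨T, ?_, ?_⟩
  · -- upper bound
    have fb3 : ∀ z, ‖z‖ ≤ 3 → ‖f z‖ ≤ 3 * K + 1 := fun z hz => by
      have := fb z 0
      rw [f0, sub_zero, sub_zero] at this
      nlinarith
    suffices hn : ‖T‖ ≤ K + η from fun u => T.le_of_opNorm_le hn u
    refine ContinuousLinearMap.opNorm_le_of_unit_norm (by positivity) fun u hu => ?_
    have hnu : ‖h • u‖ = h := by rw [norm_smul, hu, mul_one, Real.norm_of_nonneg hpos.le]
    have ψs_cont : Continuous fun z => ψ (z - h • u) := ψsm.continuous.comp (by fun_prop)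
    have int2 : Integrable (fun z => ψ (z - h • u) • f z) μ := by
      apply Continuous.integrable_of_hasCompactSupport
      · exact ψs_cont.smul fc
      · exact (ψc.comp_homeomorph (Homeomorph.subRight (h • u))).smul_right
    have int3 : Integrable (fun z => ψ z • f z) μ := by
      apply Continuous.integrable_of_hasCompactSupport
      · exact ψsm.continuous.smul fc
      · exact ψc.smul_right
    have int4 : Integrable (fun z => ψ z • f (z + h • u)) μ := by
      apply Continuous.integrable_of_hasCompactSupport
      · exact ψsm.continuous.smul (fc.comp (by fun_prop))
      · exact ψc.smul_right
    have e1 : h • T u = (∫ z, ψ z • (f (z + h • u) - f z) ∂μ)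
        - ∫ z, (ψ (z - h • u) - ψ z + fderiv ℝ ψ z (h • u)) • f z ∂μ := by
      have a1 : ∫ z, ψ z • (f (z + h • u) - f z) ∂μ =
          (∫ z, ψ (z - h • u) • f z ∂μ) - ∫ z, ψ z • f z ∂μ := by
        simp only [smul_sub]
        rw [integral_sub int4 int3]
        congr 1
        rw [← integral_add_right_eq_self (μ := μ) (fun z => ψ (z - h • u) • f z) (h • u)]
        simp
      have a2 : ∫ z, (ψ (z - h • u) - ψ z + fderiv ℝ ψ z (h • u)) • f z ∂μ =
          (∫ z, ψ (z - h • u) • f z ∂μ) - (∫ z, ψ z • f z ∂μ)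
            + ∫ z, fderiv ℝ ψ z (h • u) • f z ∂μ := by
        simp only [add_smul, sub_smul]
        rw [← integral_sub int2 int3]
        exact integral_add (int2.sub int3) (int1 _)
      rw [a1, a2, ← map_smul, hT]
      abel
    have b1 : ‖∫ z, ψ z • (f (z + h • u) - f z) ∂μ‖ ≤ K * h + δ := by
      calc ‖∫ z, ψ z • (f (z + h • u) - f z) ∂μ‖ ≤ ∫ z, ψ z * (K * h + δ) ∂μ := by
            refine norm_integral_le_of_norm_le (ψint.mul_const _) (Eventually.of_forall fun z => ?_)
            rw [norm_smul, Real.norm_of_nonneg (ψnn z)]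
            refine mul_le_mul_of_nonneg_left ?_ (ψnn z)
            have := fb (z + h • u) z
            rwa [add_sub_cancel_left, hnu] at this
        _ = K * h + δ := by rw [integral_mul_const, ψi, one_mul]
    have b2 : ‖∫ z, (ψ (z - h • u) - ψ z + fderiv ℝ ψ z (h • u)) • f z ∂μ‖ ≤ h * (η / 2) := by
      have hz : ∀ z ∉ closedBall (0 : E) 3,
          (ψ (z - h • u) - ψ z + fderiv ℝ ψ z (h • u)) • f z = 0 := by
        intro z hz
        have hz3 : 3 < ‖z‖ := by simpa using hz
        have : 2 < ‖z - h • u‖ := by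
          have := norm_sub_norm_le z (h • u)
          rw [hnu] at this; linarith
        rw [ψ0 _ this, ψ0 z (by linarith), dψ0 z (by linarith)]
        simp
      rw [← setIntegral_eq_integral_of_forall_compl_eq_zero hz]
      calc _ ≤ (D * h * h * (3 * K + 1)) * μ.real (closedBall (0 : E) 3) := by
            refine norm_setIntegral_le_of_norm_le_const
              (isCompact_closedBall _ _).measure_lt_top fun z hz => ?_
            rw [norm_smul]
            have t := taylor z (h • u)
            rw [hnu] at t
            have := fb3 z (by simpa using hz)
            rw [Real.norm_eq_abs]
            gcongr
        _ = h * (Q * h) := by rw [hQ]; ring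
        _ ≤ h * (η / 2) := by gcongr
    have : h * ‖T u‖ ≤ h * (K + η) := by
      calc h * ‖T u‖ = ‖h • T u‖ := by rw [norm_smul, Real.norm_of_nonneg hpos.le]
        _ ≤ (K * h + δ) + h * (η / 2) := by
            rw [e1]; exact (norm_sub_le _ _).trans (add_le_add b1 b2)
        _ ≤ h * (K + η) := by linarith
    exact le_of_mul_le_mul_left this hpos
  · intro g l hgl u
    have int5 : Integrable (fun z => fderiv ℝ ψ z u * g (f z)) μ := by
      have := g.integrable_comp (int1 u)
      simpa using this
    have int6 : Integrable (fun z => fderiv ℝ ψ z u * l z) μ := by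
      apply Continuous.integrable_of_hasCompactSupport
      · exact (dψcont.clm_apply continuous_const).mul l.continuous
      · exact (dψc.comp_left (g := fun L : StrongDual ℝ E => L u) rfl).mul_right
    have e1 : g (T u) = -∫ z, fderiv ℝ ψ z u * g (f z) ∂μ := by
      rw [hT, map_neg, ← g.integral_comp_comm (int1 u)]
      simp
    have e2 : l u = -∫ z, fderiv ℝ ψ z u * l z ∂μ := by
      rw [← integral_mul_fderiv_eq_neg_fderiv_mul_of_integrable int6]
      · simp [integral_mul_const, ψi]
      · simpa using ψint.mul_const (l u)
      · exact (ψsm.continuous.mul l.continuous).integrable_of_hasCompactSupport ψc.mul_right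
      · exact fun x _ => ψdiff x
      · exact fun x _ => l.differentiableAt
    have e3 : g (T u) - l u = -∫ z, fderiv ℝ ψ z u * (g (f z) - l z) ∂μ := by
      simp only [mul_sub]
      rw [integral_sub int5 int6, e1, e2]; ring
    rw [e3, abs_neg, ← Real.norm_eq_abs]
    calc _ ≤ ∫ z, ‖fderiv ℝ ψ z‖ * (‖u‖ * δ) ∂μ := by
          refine norm_integral_le_of_norm_le (dψint.mul_const _) (Eventually.of_forall fun z => ?_)
          by_cases hz : ‖z‖ ≤ 2
          · rw [norm_mul, ← mul_assoc]
            gcongr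
            · exact (fderiv ℝ ψ z).le_opNorm u
            · exact hgl z hz
          · simp [dψ0 z (not_le.1 hz)]
      _ = (δ * M) * ‖u‖ := by rw [integral_mul_const]; ring
      _ ≤ η * ‖u‖ := by gcongr

theorem ribe_linear (E Y : Type*) [NormedAddCommGroup E] [NormedSpace ℝ E]
    [FiniteDimensional ℝ E] [NormedAddCommGroup Y] [NormedSpace ℝ Y] [CompleteSpace Y]
    (K : ℝ) (hK : 0 < K) (f : ℕ → E → Y) (a : ℕ → ℝ) (ha : Tendsto a atTop (𝓝 0))
    (ha0 : ∀ n, 0 ≤ a n) (ha1 : ∀ n, a n ≤ 1)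
    (fc : ∀ n, Continuous (f n)) (f0 : ∀ n, f n 0 = 0)
    (fu : ∀ n x y, ‖f n x - f n y‖ ≤ K * ‖x - y‖ + K * a n)
    (fl : ∀ n x y, ‖x - y‖ ≤ K * ‖f n x - f n y‖ + K * a n) :
    ∃ T : E →L[ℝ] Y, (∀ u, ‖T u‖ ≤ (K + 1) * ‖u‖) ∧ ∀ u, ‖u‖ ≤ (2 * K) * ‖T u‖ := by
  borelize E
  let μ : Measure E := Measure.addHaar
  let U : Ultrafilter ℕ := hyperfilter ℕ
  have hU : (U : Filter ℕ) ≤ atTop := Nat.hyperfilter_le_atTop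
  have haU : Tendsto a U (𝓝 0) := ha.mono_left hU
  let d : ℕ → E := TopologicalSpace.denseSeq E
  -- norming functionals
  have hg : ∀ (i : ℕ × ℕ) (n : ℕ), ∃ g : StrongDual ℝ Y, ‖g‖ ≤ 1 ∧
      g (f n (d i.1) - f n (d i.2)) = ‖f n (d i.1) - f n (d i.2)‖ := fun i n =>
    exists_dual_vector'' ℝ _
  choose g g1 gn using hg
  have gle : ∀ i n y, |g i n y| ≤ ‖y‖ := fun i n y => by
    have := (g i n).le_of_opNorm_le (g1 i n) y
    simpa using this
  have gcoarse : ∀ i n x y, |g i n (f n x) - g i n (f n y)| ≤ K * ‖x - y‖ + K * a n := by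
    intro i n x y
    rw [← map_sub]
    exact (gle i n _).trans (fu n x y)
  -- the limit functions
  have hF : ∀ (i : ℕ × ℕ) (x : E), ∃ r : ℝ, Tendsto (fun n => g i n (f n x)) U (𝓝 r) := by
    intro i x
    have hmem : ∀ n, g i n (f n x) ∈ Icc (-(K * ‖x‖ + K)) (K * ‖x‖ + K) := fun n => by
      rw [mem_Icc, ← abs_le]
      have := gcoarse i n x 0
      rw [f0, map_zero, sub_zero, sub_zero] at this
      nlinarith [ha1 n]
    obtain ⟨r, -, hr⟩ := (isCompact_Icc (a := -(K * ‖x‖ + K)) (b := K * ‖x‖ + K)).ultrafilter_le_nhds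
      (U.map fun n => g i n (f n x)) (by
        rw [le_principal_iff]
        exact Filter.mem_map.2 (Filter.univ_mem' hmem))
    exact ⟨r, hr⟩
  choose F hF using hF
  have FK : ∀ i x y, |F i x - F i y| ≤ K * ‖x - y‖ := by
    intro i x y
    have t1 : Tendsto (fun n => |g i n (f n x) - g i n (f n y)|) U (𝓝 |F i x - F i y|) :=
      ((hF i x).sub (hF i y)).abs
    have t2 : Tendsto (fun n => K * ‖x - y‖ + K * a n) U (𝓝 (K * ‖x - y‖ + K * 0)) :=
      tendsto_const_nhds.add (haU.const_mul K)
    have := le_of_tendsto_of_tendsto' t1 t2 (fun n => gcoarse i n x y)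
    simpa using this
  have FL : ∀ i, LipschitzWith K.toNNReal (F i) := fun i =>
    LipschitzWith.of_dist_le_mul fun x y => by
      rw [Real.dist_eq, dist_eq_norm, Real.coe_toNNReal K hK.le]; exact FK i x y
  have Flow : ∀ j k, ‖d j - d k‖ ≤ K * (F (j, k) (d j) - F (j, k) (d k)) := by
    intro j k
    have t1 : Tendsto (fun n => K * (g (j, k) n (f n (d j)) - g (j, k) n (f n (d k))) + K * a n) U
        (𝓝 (K * (F (j, k) (d j) - F (j, k) (d k)) + K * 0)) :=
      (((hF (j, k) (d j)).sub (hF (j, k) (d k))).const_mul K).add (haU.const_mul K)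
    rw [mul_zero, add_zero] at t1
    refine ge_of_tendsto' t1 fun n => ?_
    rw [← map_sub, gn (j, k) n]
    exact fl n _ _
  -- parameters
  set q : ℝ := 1 / (8 * K) with hq
  have hq0 : 0 < q := by positivity
  have hKq : 1 / K = 8 * q := by rw [hq]; field_simp
  set θ : ℝ := q / (K + 1) with hθ
  have hθ0 : 0 < θ := by positivity
  obtain ⟨N, hNs, hNf, hN⟩ := (isCompact_sphere (0 : E) 1).finite_cover_balls hθ0
  have hN1 : ∀ u ∈ N, ‖u‖ = 1 := fun u hu => by simpa using hNs hu
  -- lower bound a.e.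
  have ae1 : ∀ᵐ x ∂μ, ∀ u ∈ N, ∃ i, 6 * q ≤ lineDeriv ℝ (F i) x u := by
    refine (ae_ball_iff hNf.countable).2 fun u hu => ?_
    refine ribe_ae_lineDeriv μ F K.toNNReal FL (6 * q) (7 * q) (by linarith) u fun x t ht => ?_
    set s : ℝ := q * t / (2 * (1 / K + K)) with hs
    have hs0 : 0 < s := by positivity
    have hse : 2 * s * (1 / K + K) = q * t := by rw [hs]; field_simp
    obtain ⟨j, hj⟩ := (TopologicalSpace.denseRange_denseSeq E).exists_dist_lt (x + t • u) hs0
    obtain ⟨k, hk⟩ := (TopologicalSpace.denseRange_denseSeq E).exists_dist_lt x hs0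
    change dist (x + t • u) (d j) < s at hj
    change dist x (d k) < s at hk
    rw [dist_eq_norm] at hj hk
    refine ⟨(j, k), ?_⟩
    have b1 := (abs_le.1 (FK (j, k) (x + t • u) (d j))).1
    have b2 := (abs_le.1 (FK (j, k) x (d k))).2
    have b3 := Flow j k
    have b4 : t - 2 * s ≤ ‖d j - d k‖ := by
      have e : t • u = (x + t • u - d j) + (d j - d k) - (x - d k) := by abel
      have : ‖t • u‖ = t := by rw [norm_smul, hN1 u hu, mul_one, Real.norm_of_nonneg ht.le]
      have h3 : ‖t • u‖ ≤ ‖x + t • u - d j‖ + ‖d j - d k‖ + ‖x - d k‖ := by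
        conv_lhs => rw [e]
        exact (norm_sub_le _ _).trans (by gcongr; exact norm_add_le _ _)
      linarith
    have b5 : (t - 2 * s) / K ≤ F (j, k) (d j) - F (j, k) (d k) := by
      rw [div_le_iff₀ hK]; linarith
    have b6 : (t - 2 * s) / K = t * (1 / K) - 2 * s * (1 / K) := by ring
    have b7 : K * ‖x + t • u - d j‖ ≤ K * s := by gcongr
    have b8 : K * ‖x - d k‖ ≤ K * s := by gcongr
    rw [hKq] at b6 hse
    nlinarith
  have ae2 : ∀ᵐ x ∂μ, ∀ i, DifferentiableAt ℝ (F i) x :=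
    ae_all_iff.2 fun i => (FL i).ae_differentiableAt
  obtain ⟨x0, hx1, hx2⟩ := (ae1.and ae2).exists
  have hi : ∀ u : E, ∃ i, u ∈ N → 6 * q ≤ fderiv ℝ (F i) x0 u := by
    intro u
    by_cases hu : u ∈ N
    · obtain ⟨i, hi⟩ := hx1 u hu
      rw [(hx2 i).lineDeriv_eq_fderiv] at hi
      exact ⟨i, fun _ => hi⟩
    · exact ⟨(0, 0), fun h => absurd h hu⟩
  choose ix hix using hi
  set η : ℝ := min 1 q with hη
  have hη0 : 0 < η := by positivity
  obtain ⟨δ, δ0, havg⟩ := ribe_averaging E Y K hK η hη0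
  -- choose the scale
  obtain ⟨r, r0, hr⟩ : ∃ r > (0 : ℝ), ∀ u ∈ N, ∀ v : E, ‖v‖ ≤ 2 * r →
      |F (ix u) (x0 + v) - F (ix u) x0 - fderiv ℝ (F (ix u)) x0 v| ≤ δ / 4 * ‖v‖ := by
    have : ∀ᶠ v in 𝓝 (0 : E), ∀ u ∈ N,
        ‖F (ix u) (x0 + v) - F (ix u) x0 - fderiv ℝ (F (ix u)) x0 v‖ ≤ δ / 4 * ‖v‖ := by
      refine (Filter.eventually_all_finite hNf).2 fun u _ => ?_
      exact (hasFDerivAt_iff_isLittleO_nhds_zero.1 (hx2 (ix u)).hasFDerivAt).def (by positivity)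
    obtain ⟨ρ, ρ0, hρ⟩ := Metric.eventually_nhds_iff.1 this
    refine ⟨ρ / 3, by positivity, fun u hu v hv => ?_⟩
    exact hρ (y := v) (by rw [dist_zero_right]; linarith) u hu
  -- choose n
  have ev1 : ∀ᶠ n in (U : Filter ℕ), ∀ u ∈ N, ∀ z ∈ closedBall x0 (2 * r),
      |g (ix u) n (f n z) - F (ix u) z| ≤ δ * r / 4 := by
    refine (Filter.eventually_all_finite hNf).2 fun u _ => ?_
    exact ribe_unif U (fun n z => g (ix u) n (f n z)) (F (ix u)) a K hK haU
      (gcoarse (ix u)) (FK (ix u)) (hF (ix u)) _ (isCompact_closedBall _ _) _ (by positivity)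
  have ev2 : ∀ᶠ n in (U : Filter ℕ), a n < δ * r / K :=
    haU.eventually_lt_const (by positivity)
  obtain ⟨n, hn1, hn2⟩ := (ev1.and ev2).exists
  have hn2' : K * a n ≤ δ * r := by
    rw [lt_div_iff₀ hK] at hn2; linarith
  obtain ⟨T, T1, T2⟩ := havg (fun z => r⁻¹ • (f n (x0 + r • z) - f n x0))
    (by have := fc n; fun_prop) (by simp) (by
      intro x y
      rw [← smul_sub, norm_smul, Real.norm_of_nonneg (by positivity), inv_mul_le_iff₀ r0]
      have := fu n (x0 + r • x) (x0 + r • y)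
      rw [add_sub_add_left_eq_sub, ← smul_sub, norm_smul, Real.norm_of_nonneg r0.le] at this
      rw [sub_sub_sub_cancel_right]
      linarith)
  have T1' : ∀ u, ‖T u‖ ≤ (K + 1) * ‖u‖ := fun u => (T1 u).trans (by
    gcongr; exact min_le_left _ _)
  have Tlow : ∀ u ∈ N, 5 * q ≤ ‖T u‖ := by
    intro u hu
    have h1 := T2 (g (ix u) n) (fderiv ℝ (F (ix u)) x0) (by
      intro z hz
      have hv : ‖r • z‖ ≤ 2 * r := by
        rw [norm_smul, Real.norm_of_nonneg r0.le]; nlinarith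
      have c1 := hr u hu (r • z) hv
      have c2 := hn1 u hu (x0 + r • z) (by simpa using hv)
      have c3 := hn1 u hu x0 (by simp; positivity)
      have c4 : δ / 4 * ‖r • z‖ ≤ δ * r / 2 := by
        calc δ / 4 * ‖r • z‖ ≤ δ / 4 * (2 * r) := by gcongr
          _ = _ := by ring
      rw [map_smul, smul_eq_mul] at c1
      have e : (g (ix u) n) (r⁻¹ • (f n (x0 + r • z) - f n x0)) - fderiv ℝ (F (ix u)) x0 z
          = r⁻¹ * (g (ix u) n (f n (x0 + r • z)) - g (ix u) n (f n x0)
            - r * fderiv ℝ (F (ix u)) x0 z) := by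
        rw [map_smul, map_sub, smul_eq_mul]; field_simp
      rw [e, abs_mul, abs_of_pos (inv_pos.2 r0), inv_mul_le_iff₀ r0]
      rw [abs_le] at *
      constructor <;> linarith [c1.1, c1.2, c2.1, c2.2, c3.1, c3.2]) u
    rw [hN1 u hu, mul_one] at h1
    have h2 := hix u hu
    have h3 : η ≤ q := min_le_right _ _
    have h4 := (abs_le.1 h1).1
    have h5 := (abs_le.1 (gle (ix u) n (T u))).2
    linarith
  refine ⟨T, T1', fun v => ?_⟩
  have unit : ∀ w : E, ‖w‖ = 1 → 4 * q ≤ ‖T w‖ := by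
    intro w hw
    obtain ⟨u, hu, hwu⟩ : ∃ u ∈ N, dist w u < θ := by
      simpa using hN (show w ∈ sphere (0 : E) 1 by simpa using hw)
    have h1 := Tlow u hu
    have h2 := T1' (u - w)
    rw [map_sub] at h2
    have h3 : (K + 1) * ‖u - w‖ ≤ q := by
      calc (K + 1) * ‖u - w‖ ≤ (K + 1) * θ := by
            gcongr; rw [← dist_eq_norm, dist_comm]; exact hwu.le
        _ = q := by rw [hθ]; field_simp
    have h4 := norm_sub_norm_le (T u) (T w)
    linarith
  rcases eq_or_ne v 0 with rfl | hv
  · simp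
  have hv0 : 0 < ‖v‖ := norm_pos_iff.2 hv
  have h1 := unit (‖v‖⁻¹ • v) (by rw [norm_smul, norm_inv, norm_norm, inv_mul_cancel₀ hv0.ne'])
  rw [map_smul, norm_smul, norm_inv, norm_norm, le_inv_mul_iff₀ hv0] at h1
  have h2 : 2 * K * (4 * q) = 1 := by rw [hq]; field_simp; norm_num
  calc ‖v‖ = 2 * K * (‖v‖ * (4 * q)) := by linear_combination (-‖v‖) * h2
    _ ≤ 2 * K * ‖T v‖ := by gcongr

theorem ribe_half (X Y : Type*) [NormedAddCommGroup X] [NormedSpace ℝ X]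
    [NormedAddCommGroup Y] [NormedSpace ℝ Y] [CompleteSpace Y]
    (φ : X → Y) (hφ : Continuous φ) (K : ℝ) (hK : 0 < K)
    (hu : ∀ x y, ‖φ x - φ y‖ ≤ K * ‖x - y‖ + K)
    (hl : ∀ x y, ‖x - y‖ ≤ K * ‖φ x - φ y‖ + K)
    (E : Submodule ℝ X) (hE : FiniteDimensional ℝ E) :
    ∃ F : Submodule ℝ Y, FiniteDimensional ℝ F ∧
      ∃ T : E ≃L[ℝ] F, ‖(T : E →L[ℝ] F)‖ * ‖(T.symm : F →L[ℝ] E)‖ ≤ (K + 1) * (2 * K) := by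
  let f : ℕ → E → Y := fun n x =>
    ((n : ℝ) + 1)⁻¹ • (φ (((n : ℝ) + 1) • (x : X)) - φ 0)
  have hsub : ∀ (n : ℕ) (x y : E), ‖f n x - f n y‖ =
      ((n : ℝ) + 1)⁻¹ * ‖φ (((n : ℝ) + 1) • (x : X)) - φ (((n : ℝ) + 1) • (y : X))‖ := by
    intro n x y
    simp only [f]
    rw [← smul_sub, norm_smul, Real.norm_of_nonneg (by positivity), sub_sub_sub_cancel_right]
  have hns : ∀ (n : ℕ) (x y : E), ‖((n : ℝ) + 1) • (x : X) - ((n : ℝ) + 1) • (y : X)‖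
      = ((n : ℝ) + 1) * ‖x - y‖ := by
    intro n x y
    rw [← smul_sub, norm_smul, Real.norm_of_nonneg (by positivity)]
    rfl
  obtain ⟨T, T1, T2⟩ := ribe_linear E Y K hK f (fun n => 1 / ((n : ℝ) + 1))
    tendsto_one_div_add_atTop_nhds_zero_nat (fun n => by positivity)
    (fun n => by rw [div_le_one (by positivity)]; linarith [Nat.cast_nonneg (α := ℝ) n])
    (fun n => by simp only [f]; fun_prop) (fun n => by simp [f])
    (fun n x y => by
      have := hu (((n : ℝ) + 1) • (x : X)) (((n : ℝ) + 1) • (y : X))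
      rw [hns] at this
      rw [hsub, inv_mul_le_iff₀ (by positivity)]
      refine this.trans (le_of_eq ?_)
      field_simp)
    (fun n x y => by
      have := hl (((n : ℝ) + 1) • (x : X)) (((n : ℝ) + 1) • (y : X))
      rw [hns, ← le_inv_mul_iff₀ (by positivity)] at this
      rw [hsub]
      refine this.trans (le_of_eq ?_)
      field_simp)
  have hinj : Function.Injective (T : E →ₗ[ℝ] Y) := by
    rw [← LinearMap.ker_eq_bot, LinearMap.ker_eq_bot']
    intro v hv
    have := T2 v
    have hv' : T v = 0 := hv
    rw [hv', norm_zero, mul_zero] at this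
    exact norm_le_zero_iff.1 this
  let e : E ≃ₗ[ℝ] LinearMap.range (T : E →ₗ[ℝ] Y) := LinearEquiv.ofInjective _ hinj
  refine ⟨LinearMap.range (T : E →ₗ[ℝ] Y), inferInstance, e.toContinuousLinearEquiv, ?_⟩
  have he : ∀ v, ‖e v‖ = ‖T v‖ := fun v => rfl
  refine mul_le_mul ?_ ?_ (ContinuousLinearMap.opNorm_nonneg _) (by positivity)
  · refine ContinuousLinearMap.opNorm_le_bound _ (by positivity) fun v => ?_
    exact (he v).le.trans (T1 v)
  · refine ContinuousLinearMap.opNorm_le_bound _ (by positivity) fun w => ?_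
    have := T2 (e.symm w)
    rw [← he, e.apply_symm_apply] at this
    exact this

/-- Ribe's theorem: uniformly homeomorphic Banach spaces are locally equivalent,
i.e. there is a constant `C > 0` such that every finite-dimensional subspace of one
space is at Banach–Mazur distance at most `C` from some finite-dimensional subspace
of the other, and vice versa. -/
theorem ribe_uniform_homeomorphic_implies_locally_equivalent
    (X Y : Type*) [NormedAddCommGroup X] [NormedSpace ℝ X] [CompleteSpace X]
    [NormedAddCommGroup Y] [NormedSpace ℝ Y] [CompleteSpace Y]
    (φ : X ≃ Y) (hφ : UniformContinuous φ) (hφ' : UniformContinuous φ.symm) :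
    ∃ C > (0 : ℝ),
      (∀ E : Submodule ℝ X, FiniteDimensional ℝ E →
        ∃ F : Submodule ℝ Y, FiniteDimensional ℝ F ∧
          ∃ T : E ≃L[ℝ] F, ‖(T : E →L[ℝ] F)‖ * ‖(T.symm : F →L[ℝ] E)‖ ≤ C) ∧
      (∀ F : Submodule ℝ Y, FiniteDimensional ℝ F →
        ∃ E : Submodule ℝ X, FiniteDimensional ℝ E ∧
          ∃ T : F ≃L[ℝ] E, ‖(T : F →L[ℝ] E)‖ * ‖(T.symm : E →L[ℝ] F)‖ ≤ C) := by
  obtain ⟨K₁, hK₁, h1⟩ := ribe_coarse φ hφ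
  obtain ⟨K₂, hK₂, h2⟩ := ribe_coarse φ.symm hφ'
  set K := max K₁ K₂ with hKd
  have hK : 0 < K := lt_max_of_lt_left hK₁
  have h1' : ∀ x y, ‖φ x - φ y‖ ≤ K * ‖x - y‖ + K := fun x y => (h1 x y).trans (by
    gcongr <;> exact le_max_left _ _)
  have h2' : ∀ x y, ‖φ.symm x - φ.symm y‖ ≤ K * ‖x - y‖ + K := fun x y => (h2 x y).trans (by
    gcongr <;> exact le_max_right _ _)
  refine ⟨(K + 1) * (2 * K), by positivity, fun E hE => ?_, fun F hF => ?_⟩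
  · exact ribe_half X Y φ hφ.continuous K hK h1'
      (fun x y => by simpa using h2' (φ x) (φ y)) E hE
  · exact ribe_half Y X φ.symm hφ'.continuous K hK h2'
      (fun x y => by simpa using h1' (φ.symm x) (φ.symm y)) F hF
end

section
/- Let A ⊆ (2,3) be countable and q ∈ (2,3) with q ∉ A. Then ℓ_q is not isomorphic to any closed subspace of the c_0-direct sum (Σ_{p ∈ A} ⊕ ℓ_p)_{c_0}. -/
open Filter
open scoped ENNReal

/-- The sequence space `ℓ_p`. -/
noncomputable def lpSeq (p : ℝ) (hp : 1 ≤ p) : Type :=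
  lp (fun _ : ℕ => ℝ) (ENNReal.ofReal p)

noncomputable instance (p : ℝ) (hp : 1 ≤ p) : NormedAddCommGroup (lpSeq p hp) :=
  haveI : Fact (1 ≤ ENNReal.ofReal p) :=
    ⟨by simpa [ENNReal.ofReal_one] using ENNReal.ofReal_le_ofReal hp⟩
  inferInstanceAs (NormedAddCommGroup (lp (fun _ : ℕ => ℝ) (ENNReal.ofReal p)))

noncomputable instance (p : ℝ) (hp : 1 ≤ p) : NormedSpace ℝ (lpSeq p hp) :=
  haveI : Fact (1 ≤ ENNReal.ofReal p) :=
    ⟨by simpa [ENNReal.ofReal_one] using ENNReal.ofReal_le_ofReal hp⟩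
  inferInstanceAs (NormedSpace ℝ (lp (fun _ : ℕ => ℝ) (ENNReal.ofReal p)))

/-- Lower `p`-estimate. -/
def LowerEst (p : ℝ) (F : Type*) [NormedAddCommGroup F] : Prop :=
  ∀ u v : F, ‖u‖ ^ p + ‖v‖ ^ p ≤ ‖u + v‖ ^ p ∨ ‖u‖ ^ p + ‖v‖ ^ p ≤ ‖u - v‖ ^ p

/-- Asymptotic upper `p`-estimate. -/
def UpperEst (p : ℝ) (F : Type*) [NormedAddCommGroup F] [NormedSpace ℝ F] : Prop :=
  ∃ φ : ℕ → F →ₗ[ℝ] ℝ, (∀ i y, ‖φ i y‖ ≤ ‖y‖) ∧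
    ∀ (s : F) (C : ℝ) (y : ℕ → F), (∀ j, ‖y j‖ ≤ C) →
      (∀ i, Tendsto (fun j => φ i (y j)) atTop (nhds 0)) →
      ∀ᶠ j in atTop, ‖s + y j‖ ^ p ≤ ‖s‖ ^ p + C ^ p + 1

theorem abs_clarkson (p : ℝ) (hp : 2 ≤ p) (a b : ℝ) :
    2 * (|a| ^ p + |b| ^ p) ≤ |a + b| ^ p + |a - b| ^ p := by
  have key : ∀ x : ℝ, |x| ^ p = (x ^ 2) ^ (p / 2) := by
    intro x
    rw [← sq_abs, ← Real.rpow_natCast, ← Real.rpow_mul (abs_nonneg x)]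
    congr 1
    push_cast
    ring
  rw [key, key, key, key]
  have h1 := Real.add_rpow_le_rpow_add (sq_nonneg a) (sq_nonneg b) (p := p / 2) (by linarith)
  have hc := (convexOn_rpow (p := p / 2) (by linarith)).2
  have h2 := @hc _ (Set.mem_Ici.2 (sq_nonneg (a + b))) _ (Set.mem_Ici.2 (sq_nonneg (a - b)))
    (1 / 2) (1 / 2) (by norm_num) (by norm_num) (by norm_num)
  simp only [smul_eq_mul] at h2
  have h3 : 1 / 2 * (a + b) ^ 2 + 1 / 2 * (a - b) ^ 2 = a ^ 2 + b ^ 2 := by ring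
  rw [h3] at h2
  linarith

theorem lowerEst_real : LowerEst 2 ℝ := by
  intro u v
  have := abs_clarkson 2 le_rfl u v
  simp only [Real.norm_eq_abs]
  by_contra! h
  linarith [h.1, h.2]

theorem lowerEst_lp (P : ℝ≥0∞) [Fact (1 ≤ P)] (hP : 2 ≤ P.toReal) :
    LowerEst P.toReal (lp (fun _ : ℕ => ℝ) P) := by
  intro u v
  have h0 : 0 < P.toReal := by linarith
  have h1 := ((lp.hasSum_norm h0 u).add (lp.hasSum_norm h0 v)).mul_left 2
  have h2 := (lp.hasSum_norm h0 (u + v)).add (lp.hasSum_norm h0 (u - v))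
  have h3 := hasSum_le (fun i => by
    simpa using abs_clarkson P.toReal hP (u i) (v i)) h1 h2
  by_contra! h
  linarith [h.1, h.2]

theorem upperEst_lp (P : ℝ≥0∞) [Fact (1 ≤ P)] (hP : P ≠ ⊤) :
    UpperEst P.toReal (lp (fun _ : ℕ => ℝ) P) := by
  have hP0 : P ≠ 0 := (zero_lt_one.trans_le (Fact.out : 1 ≤ P)).ne'
  have h0 : 0 < P.toReal := ENNReal.toReal_pos hP0 hP
  refine ⟨fun i => lp.evalₗ (E := fun _ : ℕ => ℝ) (𝕜 := ℝ) P i, fun i y => lp.norm_apply_le_norm hP0 y i, ?_⟩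
  intro s C y hC hy
  have hC0 : 0 ≤ C := (norm_nonneg _).trans (hC 0)
  set A := ‖s‖ ^ P.toReal + C ^ P.toReal with hA
  have hA0 : 0 ≤ A := by positivity
  set B := (A + 1 / 2) ^ (1 / P.toReal) with hB
  set B' := (A + 1) ^ (1 / P.toReal) with hB'
  have hBB : B < B' := Real.rpow_lt_rpow (by positivity) (by linarith) (by positivity)
  have hBp : B ^ P.toReal = A + 1 / 2 := by
    rw [hB, ← Real.rpow_mul (by positivity), one_div_mul_cancel h0.ne', Real.rpow_one]
  have hBp' : B' ^ P.toReal = A + 1 := by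
    rw [hB', ← Real.rpow_mul (by positivity), one_div_mul_cancel h0.ne', Real.rpow_one]
  have hs := lp.hasSum_single hP s
  obtain ⟨G, hG⟩ := ((Metric.tendsto_nhds.1 hs) (B' - B) (by linarith)).exists
  set sG := ∑ i ∈ G, lp.single P i (s i) with hsG
  have hsum : Tendsto (fun j => ∑ i ∈ G, ‖s i + y j i‖ ^ P.toReal) atTop
      (nhds (∑ i ∈ G, ‖s i + 0‖ ^ P.toReal)) := by
    refine tendsto_finsetSum _ fun i _ => ?_
    exact ((tendsto_const_nhds.add (hy i)).norm).rpow_const (Or.inr h0.le)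
  have hle : ∑ i ∈ G, ‖s i + 0‖ ^ P.toReal ≤ ‖s‖ ^ P.toReal := by
    simpa using lp.sum_rpow_le_norm_rpow h0 s G
  filter_upwards [hsum.eventually_lt_const (u := ‖s‖ ^ P.toReal + 1 / 2) (by linarith)] with j hj
  have hsGi : ∀ i, sG i = if i ∈ G then s i else 0 := by
    intro i
    rw [hsG, lp.coeFn_sum]
    simp only [lp.coeFn_single, Finset.sum_apply, Finset.sum_pi_single]
  have e1 : ‖sG + y j‖ ^ P.toReal ≤
      ∑ i ∈ G, (if i ∈ G then ‖s i + y j i‖ ^ P.toReal else 0) + ‖y j‖ ^ P.toReal := by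
    refine hasSum_le (fun i => ?_) (lp.hasSum_norm h0 (sG + y j))
      ((hasSum_sum_of_ne_finset_zero (fun i hi => if_neg hi)).add (lp.hasSum_norm h0 (y j)))
    rw [lp.coeFn_add, Pi.add_apply, hsGi]
    by_cases hi : i ∈ G
    · simp only [hi, if_true]
      have : 0 ≤ ‖y j i‖ ^ P.toReal := by positivity
      linarith
    · simp [hi]
  have e2 : ∑ i ∈ G, (if i ∈ G then ‖s i + y j i‖ ^ P.toReal else 0)
      = ∑ i ∈ G, ‖s i + y j i‖ ^ P.toReal := Finset.sum_congr rfl fun i hi => if_pos hi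
  have e3 : ‖y j‖ ^ P.toReal ≤ C ^ P.toReal :=
    Real.rpow_le_rpow (norm_nonneg _) (hC j) h0.le
  have e4 : ‖sG + y j‖ ≤ B := by
    rw [← Real.rpow_le_rpow_iff (norm_nonneg _) (by positivity) h0, hBp]
    linarith
  have e5 : ‖s + y j‖ ≤ B' := by
    have : s + y j = (sG + y j) - (sG - s) := by abel
    rw [this]
    rw [dist_eq_norm] at hG
    linarith [norm_sub_le (sG + y j) (sG - s)]
  calc _ ≤ B' ^ P.toReal := Real.rpow_le_rpow (norm_nonneg _) e5 h0.le
    _ = _ := hBp'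

/-- Support in `[a, b)`. -/
def SuppIn {P : ℝ≥0∞} (x : lp (fun _ : ℕ => ℝ) P) (a b : ℕ) : Prop :=
  ∀ i, x i ≠ 0 → a ≤ i ∧ i < b

theorem SuppIn.smul {P : ℝ≥0∞} {x : lp (fun _ : ℕ => ℝ) P} {a b : ℕ} (h : SuppIn x a b) (c : ℝ) :
    SuppIn (c • x) a b := by
  intro i hi
  apply h i
  intro h0
  apply hi
  simp [h0]

theorem SuppIn.mono {P : ℝ≥0∞} {x : lp (fun _ : ℕ => ℝ) P} {a b a' b' : ℕ} (h : SuppIn x a b)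
    (ha : a' ≤ a) (hb : b ≤ b') : SuppIn x a' b' := by
  intro i hi
  have := h i hi
  omega

theorem SuppIn.norm_add {P : ℝ≥0∞} [Fact (1 ≤ P)] (h0 : 0 < P.toReal)
    {x y : lp (fun _ : ℕ => ℝ) P} {a b c : ℕ} (hx : SuppIn x a b) (hy : SuppIn y b c) :
    ‖x + y‖ ^ P.toReal = ‖x‖ ^ P.toReal + ‖y‖ ^ P.toReal := by
  refine (lp.hasSum_norm h0 (x + y)).unique ?_
  convert (lp.hasSum_norm h0 x).add (lp.hasSum_norm h0 y) using 2 with i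
  rw [lp.coeFn_add, Pi.add_apply]
  by_cases h : x i = 0
  · simp [h, Real.zero_rpow h0.ne']
  · have : y i = 0 := by
      by_contra h'
      have h1 := hx i h
      have h2 := hy i h'
      omega
    simp [this, Real.zero_rpow h0.ne']

theorem SuppIn.add {P : ℝ≥0∞} {x y : lp (fun _ : ℕ => ℝ) P} {a b c : ℕ}
    (hx : SuppIn x a b) (hy : SuppIn y b c) (hab : a ≤ b) (hbc : b ≤ c) : SuppIn (x + y) a c := by
  intro i hi
  by_cases h : x i = 0
  · have h' : y i ≠ 0 := by
      intro h'
      apply hi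
      simp [h, h']
    have := hy i h'
    omega
  · have := hx i h
    omega

theorem grow {Q : ℝ≥0∞} [Fact (1 ≤ Q)] (h0 : 0 < Q.toReal)
    (P : ℕ → lp (fun _ : ℕ => ℝ) Q → Prop) (M0 : ℕ) (hP : P 0 0)
    (step : ∀ K z M, M0 ≤ M → SuppIn z M0 M → P K z →
      ∃ x M', M ≤ M' ∧ SuppIn x M M' ∧ ‖x‖ = 1 ∧ P (K + 1) (z + x)) (K : ℕ) :
    ∃ z M, M0 ≤ M ∧ SuppIn z M0 M ∧ ‖z‖ ^ Q.toReal = K ∧ P K z := by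
  induction K with
  | zero =>
    refine ⟨0, M0, le_rfl, fun i hi => (hi rfl).elim, ?_, hP⟩
    simp [Real.zero_rpow h0.ne']
  | succ K ih =>
    obtain ⟨z, M, hM, hz, hn, hPz⟩ := ih
    obtain ⟨x, M', hM', hx, hx1, hPx⟩ := step K z M hM hz hPz
    refine ⟨z + x, M', hM.trans hM', hz.add hx hM hM', ?_, hPx⟩
    rw [hz.norm_add h0 hx, hn, hx1]
    simp

theorem norm_eq_of_rpow {a q : ℝ} (ha : 0 ≤ a) (hq : 0 < q) {K : ℝ} (h : a ^ q = K) :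
    a = K ^ (1 / q) := by
  rw [← h, ← Real.rpow_mul ha, mul_one_div_cancel hq.ne', Real.rpow_one]

theorem tail_small {Q : ℝ≥0∞} [Fact (1 ≤ Q)] {p : ℝ} (hp : 0 < p) (hpQ : p < Q.toReal)
    {F : Type*} [NormedAddCommGroup F] [NormedSpace ℝ F] (hF : LowerEst p F)
    (T : lp (fun _ : ℕ => ℝ) Q →ₗ[ℝ] F) (C : ℝ) (hC0 : 0 ≤ C) (hC : ∀ x, ‖T x‖ ≤ C * ‖x‖)
    (ε : ℝ) (hε : 0 < ε) :
    ∃ M, ∀ x M', SuppIn x M M' → ‖T x‖ ≤ ε * ‖x‖ := by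
  have h0 : 0 < Q.toReal := hp.trans hpQ
  by_contra! hcon
  have hg := grow h0 (fun K z => K * ε ^ p ≤ ‖T z‖ ^ p) 0 (by simp [Real.zero_rpow hp.ne']) (by
    intro K z M _ _ hKz
    obtain ⟨x, M', hx, hlt⟩ := hcon M
    have hxn : 0 < ‖x‖ := by
      rcases (norm_nonneg x).eq_or_lt with h | h
      · have := hC x
        rw [← h] at this hlt
        linarith
      · exact h
    have hxs : SuppIn (‖x‖⁻¹ • x) M (max M M') :=
      (hx.smul _).mono le_rfl (le_max_right _ _)
    have hx1 : ‖‖x‖⁻¹ • x‖ = 1 := by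
      rw [norm_smul, norm_inv, norm_norm, inv_mul_cancel₀ hxn.ne']
    have hTx : ε ≤ ‖T (‖x‖⁻¹ • x)‖ := by
      rw [map_smul, norm_smul, norm_inv, norm_norm, ← div_eq_inv_mul, le_div_iff₀ hxn]
      exact hlt.le
    have hTp : ε ^ p ≤ ‖T (‖x‖⁻¹ • x)‖ ^ p := Real.rpow_le_rpow hε.le hTx hp.le
    generalize ‖x‖⁻¹ • x = x' at *
    rcases hF (T z) (T x') with h | h
    · refine ⟨x', _, le_max_left _ _, hxs, hx1, ?_⟩
      rw [map_add]
      push_cast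
      linarith
    · refine ⟨(-1 : ℝ) • x', _, le_max_left _ _, hxs.smul _, ?_, ?_⟩
      · rw [norm_smul, hx1]
        simp
      · rw [map_add, map_smul, neg_one_smul, ← sub_eq_add_neg]
        push_cast
        linarith)
  have hb : ∀ K : ℕ, 1 ≤ K → ε ^ p ≤ C ^ p * (K : ℝ) ^ (-(1 - p / Q.toReal)) := by
    intro K hK
    obtain ⟨z, M, _, _, hn, hz⟩ := hg K
    have hK' : (0 : ℝ) < K := by exact_mod_cast hK
    have h1 : ‖T z‖ ^ p ≤ (C * ‖z‖) ^ p := Real.rpow_le_rpow (norm_nonneg _) (hC z) hp.le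
    rw [Real.mul_rpow hC0 (norm_nonneg _), norm_eq_of_rpow (norm_nonneg _) h0 hn,
      ← Real.rpow_mul hK'.le] at h1
    have h2 : (K : ℝ) ^ (-(1 - p / Q.toReal)) = (K : ℝ) ^ (1 / Q.toReal * p) / K := by
      rw [← Real.rpow_sub_one hK'.ne']
      congr 1
      ring
    rw [h2, ← mul_div_assoc, le_div_iff₀ hK']
    linarith
  have hlim : Tendsto (fun K : ℕ => C ^ p * (K : ℝ) ^ (-(1 - p / Q.toReal))) atTop
      (nhds (C ^ p * 0)) :=
    ((tendsto_rpow_neg_atTop (by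
      have : p / Q.toReal < 1 := (div_lt_one h0).2 hpQ
      linarith)).comp tendsto_natCast_atTop_atTop).const_mul _
  have := ge_of_tendsto hlim (eventually_atTop.2 ⟨1, hb⟩)
  have h3 : 0 < ε ^ p := Real.rpow_pos_of_pos hε p
  linarith

theorem upper_avg {Q : ℝ≥0∞} [Fact (1 ≤ Q)] (hQ : 2 < Q.toReal)
    {F : ℕ → Type*} [∀ n, NormedAddCommGroup (F n)] [∀ n, NormedSpace ℝ (F n)]
    (T : ∀ n, lp (fun _ : ℕ => ℝ) Q →ₗ[ℝ] F n) (C : ℝ) (hC0 : 0 ≤ C)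
    (hC : ∀ n x, ‖T n x‖ ≤ C * ‖x‖) (p : ℕ → ℝ) (G : Finset ℕ)
    (hG : ∀ n ∈ G, 0 < p n ∧ UpperEst (p n) (F n)) (M0 K : ℕ) :
    ∃ z M, M0 ≤ M ∧ SuppIn z M0 M ∧ ‖z‖ ^ Q.toReal = K ∧
      ∀ n ∈ G, ‖T n z‖ ^ p n ≤ K * (C ^ p n + 1) := by
  have hQ0 : 0 < Q := zero_lt_one.trans_le Fact.out
  refine grow (by linarith) (fun K z => ∀ n ∈ G, ‖T n z‖ ^ p n ≤ K * (C ^ p n + 1)) M0 ?_ ?_ K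
  · intro n hn
    simp [Real.zero_rpow (hG n hn).1.ne']
  · intro K z M _ _ hz
    have hsupp : ∀ j, SuppIn (lp.single Q j (1 : ℝ) : lp (fun _ : ℕ => ℝ) Q) j (j + 1) := by
      intro j i hi
      have : i = j := by
        by_contra h
        exact hi (lp.single_apply_ne Q j 1 h)
      omega
    have hnorm : ∀ j, ‖(lp.single Q j (1 : ℝ) : lp (fun _ : ℕ => ℝ) Q)‖ = 1 := by
      intro j
      rw [lp.norm_single hQ0]
      simp
    have hev : ∀ n ∈ G, ∀ᶠ j in atTop,
        ‖T n z + T n (lp.single Q j (1 : ℝ))‖ ^ p n ≤ ‖T n z‖ ^ p n + C ^ p n + 1 := by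
      intro n hn
      obtain ⟨_, φ, hφ, hU⟩ := hG n hn
      refine hU (T n z) C (fun j => T n (lp.single Q j (1 : ℝ))) (fun j => ?_) (fun i => ?_)
      · have := hC n (lp.single Q j (1 : ℝ))
        rwa [hnorm, mul_one] at this
      · rw [Metric.tendsto_atTop]
        intro ε hε
        obtain ⟨m, hm⟩ := tail_small (by norm_num) hQ lowerEst_real ((φ i).comp (T n)) C hC0
          (fun x => (hφ i _).trans (hC n x)) (ε / 2) (by linarith)
        refine ⟨m, fun j hj => ?_⟩
        have := hm _ (j + 1) ((hsupp j).mono hj le_rfl)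
        rw [hnorm] at this
        rw [dist_zero_right]
        simp only [LinearMap.comp_apply] at this
        linarith
    obtain ⟨j, hj, hjM⟩ := (((Filter.eventually_all_finset G).2 hev).and
      (eventually_ge_atTop M)).exists
    refine ⟨lp.single Q j (1 : ℝ), j + 1, by omega, (hsupp j).mono hjM le_rfl, hnorm j, ?_⟩
    intro n hn
    have h1 := hj n hn
    have h2 := hz n hn
    rw [map_add]
    push_cast
    linarith

theorem key_small {Q : ℝ≥0∞} [Fact (1 ≤ Q)] (hQ : 2 < Q.toReal)
    {F : ℕ → Type*} [∀ n, NormedAddCommGroup (F n)] [∀ n, NormedSpace ℝ (F n)]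
    (T : ∀ n, lp (fun _ : ℕ => ℝ) Q →ₗ[ℝ] F n) (C : ℝ) (hC0 : 0 ≤ C)
    (hC : ∀ n x, ‖T n x‖ ≤ C * ‖x‖) (p : ℕ → ℝ) (hp0 : ∀ n, 0 < p n)
    (hL : ∀ n, LowerEst (p n) (F n)) (hU : ∀ n, UpperEst (p n) (F n))
    (hne : ∀ n, Q.toReal ≠ p n) (M0 N : ℕ) (ε : ℝ) (hε : 0 < ε) :
    ∃ x M, M0 ≤ M ∧ SuppIn x M0 M ∧ ‖x‖ = 1 ∧ ∀ n < N, ‖T n x‖ ≤ ε := by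
  have hQ0 : 0 < Q.toReal := by linarith
  have hm : ∀ n, ∃ m, p n < Q.toReal → ∀ x M', SuppIn x m M' → ‖T n x‖ ≤ ε * ‖x‖ := by
    intro n
    by_cases h : p n < Q.toReal
    · obtain ⟨m, hm⟩ := tail_small (hp0 n) h (hL n) (T n) C hC0 (hC n) ε hε
      exact ⟨m, fun _ => hm⟩
    · exact ⟨0, fun h' => (h h').elim⟩
  choose m hm using hm
  set M1 := max M0 ((Finset.range N).sup m) with hM1
  set G := (Finset.range N).filter (fun n => Q.toReal < p n) with hGdef
  have hev : ∀ n ∈ G, ∀ᶠ K : ℕ in atTop,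
      (K : ℝ) ^ (-(p n / Q.toReal - 1)) * (C ^ p n + 1) < ε ^ p n := by
    intro n hn
    have hn' : Q.toReal < p n := (Finset.mem_filter.1 hn).2
    have hlim : Tendsto (fun K : ℕ => (K : ℝ) ^ (-(p n / Q.toReal - 1)) * (C ^ p n + 1)) atTop
        (nhds (0 * (C ^ p n + 1))) :=
      ((tendsto_rpow_neg_atTop (by
        have : 1 < p n / Q.toReal := (one_lt_div hQ0).2 hn'
        linarith)).comp tendsto_natCast_atTop_atTop).mul_const _
    refine hlim.eventually_lt_const ?_
    rw [zero_mul]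
    exact Real.rpow_pos_of_pos hε _
  obtain ⟨K, hK, hK1⟩ := (((Filter.eventually_all_finset G).2 hev).and
      (eventually_ge_atTop 1)).exists
  have hK' : (0 : ℝ) < K := by exact_mod_cast hK1
  obtain ⟨z, M, hM, hz, hn, hTz⟩ := upper_avg hQ T C hC0 hC p G (fun n _ => ⟨hp0 n, hU n⟩) M1 K
  have hzn := norm_eq_of_rpow (norm_nonneg z) hQ0 hn
  have hzpos : 0 < ‖z‖ := by
    rw [hzn]
    exact Real.rpow_pos_of_pos hK' _
  have hx1 : ‖‖z‖⁻¹ • z‖ = 1 := by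
    rw [norm_smul, norm_inv, norm_norm, inv_mul_cancel₀ hzpos.ne']
  refine ⟨‖z‖⁻¹ • z, M, (le_max_left _ _).trans hM,
    (hz.smul _).mono (le_max_left _ _) le_rfl, hx1, ?_⟩
  intro n hnN
  rcases lt_or_gt_of_ne (hne n) with h | h
  · have hnG : n ∈ G := Finset.mem_filter.2 ⟨Finset.mem_range.2 hnN, h⟩
    rw [map_smul, norm_smul, norm_inv, norm_norm, ← div_eq_inv_mul,
      ← Real.rpow_le_rpow_iff (by positivity) hε.le (hp0 n),
      Real.div_rpow (norm_nonneg _) (norm_nonneg _)]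
    have hzp : ‖z‖ ^ p n = (K : ℝ) ^ (p n / Q.toReal) := by
      rw [hzn, ← Real.rpow_mul hK'.le]
      congr 1
      ring
    have h1 := hTz n hnG
    have h2 := hK n hnG
    have h3 : (K : ℝ) ^ (-(p n / Q.toReal - 1)) = K / (K : ℝ) ^ (p n / Q.toReal) := by
      rw [show -(p n / Q.toReal - 1) = 1 - p n / Q.toReal by ring, Real.rpow_sub hK', Real.rpow_one]
    rw [h3] at h2
    rw [hzp]
    calc _ ≤ (K * (C ^ p n + 1)) / (K : ℝ) ^ (p n / Q.toReal) := by gcongr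
      _ = K / (K : ℝ) ^ (p n / Q.toReal) * (C ^ p n + 1) := by ring
      _ ≤ _ := h2.le
  · have := hm n h (‖z‖⁻¹ • z) M ((hz.smul _).mono
      ((Finset.le_sup (Finset.mem_range.2 hnN)).trans (le_max_right _ _)) le_rfl)
    rwa [hx1, mul_one] at this

theorem main_abstract {Q : ℝ≥0∞} [Fact (1 ≤ Q)] (hQ : 2 < Q.toReal)
    {F : ℕ → Type*} [∀ n, NormedAddCommGroup (F n)] [∀ n, NormedSpace ℝ (F n)]
    (T : ∀ n, lp (fun _ : ℕ => ℝ) Q →ₗ[ℝ] F n) (C : ℝ) (hC0 : 0 ≤ C)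
    (hC : ∀ n x, ‖T n x‖ ≤ C * ‖x‖) (p : ℕ → ℝ) (hp0 : ∀ n, 0 < p n)
    (hL : ∀ n, LowerEst (p n) (F n)) (hU : ∀ n, UpperEst (p n) (F n))
    (hne : ∀ n, Q.toReal ≠ p n) (hT : ∀ x, Tendsto (fun n => ‖T n x‖) atTop (nhds 0)) (K : ℕ) :
    ∃ z : lp (fun _ : ℕ => ℝ) Q, ‖z‖ ^ Q.toReal = K ∧ ∀ n, ‖T n z‖ ≤ C + 1 := by
  obtain ⟨z, M, _, _, hz, r, hr, hzr⟩ := grow (by linarith)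
    (fun _ z => ∃ r < C + 1, ∀ n, ‖T n z‖ ≤ r) 0 ⟨0, by linarith, by simp⟩ (by
      rintro _ z M - - ⟨r, hr, hzr⟩
      set δ := min (1 / 2) ((C + 1 - r) / 2) with hδ
      have hδ0 : 0 < δ := lt_min (by norm_num) (by linarith)
      have hδ1 : δ ≤ 1 / 2 := min_le_left _ _
      have hδ2 : δ ≤ (C + 1 - r) / 2 := min_le_right _ _
      obtain ⟨N, hN⟩ := eventually_atTop.1 ((hT z).eventually_lt_const hδ0)
      obtain ⟨x, M', hM', hx, hx1, hxs⟩ :=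
        key_small hQ T C hC0 hC p hp0 hL hU hne M N δ hδ0
      refine ⟨x, M', hM', hx, hx1, max (r + δ) (C + δ), max_lt (by linarith) (by linarith), ?_⟩
      intro n
      rw [map_add]
      refine (norm_add_le _ _).trans ?_
      rcases lt_or_ge n N with h | h
      · exact le_trans (add_le_add (hzr n) (hxs n h)) (le_max_left _ _)
      · have h1 := hC n x
        rw [hx1, mul_one] at h1
        have h2 := hN n h
        exact le_trans (by linarith) (le_max_right _ _)) K
  exact ⟨z, hz, fun n => (hzr n).trans hr.le⟩

theorem lowerEst_lpSeq (p : ℝ) (hp : 1 ≤ p) (h2 : 2 ≤ p) : LowerEst p (lpSeq p hp) := by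
  haveI : Fact (1 ≤ ENNReal.ofReal p) :=
    ⟨by simpa [ENNReal.ofReal_one] using ENNReal.ofReal_le_ofReal hp⟩
  have e : (ENNReal.ofReal p).toReal = p := ENNReal.toReal_ofReal (by linarith)
  have := lowerEst_lp (ENNReal.ofReal p) (by rw [e]; exact h2)
  rw [e] at this
  exact this

theorem upperEst_lpSeq (p : ℝ) (hp : 1 ≤ p) : UpperEst p (lpSeq p hp) := by
  haveI : Fact (1 ≤ ENNReal.ofReal p) :=
    ⟨by simpa [ENNReal.ofReal_one] using ENNReal.ofReal_le_ofReal hp⟩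
  have e : (ENNReal.ofReal p).toReal = p := ENNReal.toReal_ofReal (by linarith)
  have := upperEst_lp (ENNReal.ofReal p) ENNReal.ofReal_ne_top
  rw [e] at this
  exact this

theorem main_lpSeq (q : ℝ) (hq1 : 1 ≤ q) (hq : 2 < q)
    {F : ℕ → Type*} [∀ n, NormedAddCommGroup (F n)] [∀ n, NormedSpace ℝ (F n)]
    (T : ∀ n, lpSeq q hq1 →ₗ[ℝ] F n) (C : ℝ) (hC0 : 0 ≤ C)
    (hC : ∀ n x, ‖T n x‖ ≤ C * ‖x‖) (p : ℕ → ℝ) (hp0 : ∀ n, 0 < p n)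
    (hL : ∀ n, LowerEst (p n) (F n)) (hU : ∀ n, UpperEst (p n) (F n))
    (hne : ∀ n, q ≠ p n) (hT : ∀ x, Tendsto (fun n => ‖T n x‖) atTop (nhds 0)) (K : ℕ) :
    ∃ z : lpSeq q hq1, ‖z‖ ^ q = K ∧ ∀ n, ‖T n z‖ ≤ C + 1 := by
  haveI : Fact (1 ≤ ENNReal.ofReal q) :=
    ⟨by simpa [ENNReal.ofReal_one] using ENNReal.ofReal_le_ofReal hq1⟩
  have e : (ENNReal.ofReal q).toReal = q := ENNReal.toReal_ofReal (by linarith)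
  have := main_abstract (Q := ENNReal.ofReal q) (by rw [e]; exact hq) T C hC0 hC p hp0 hL hU
    (by rw [e]; exact hne) hT K
  rw [e] at this
  exact this

theorem embed_bounds {E X : Type*} [NormedAddCommGroup E] [NormedSpace ℝ E]
    [NormedAddCommGroup X] [NormedSpace ℝ X] (Y : Submodule ℝ X) (S : Submodule ℝ Y)
    (e : E ≃L[ℝ] S) : ∃ (J : E →L[ℝ] X) (D : ℝ), 0 ≤ D ∧ (∀ x, J x ∈ Y) ∧
      ∀ x, ‖x‖ ≤ D * ‖J x‖ := by
  refine ⟨(Y.subtypeL.comp S.subtypeL).comp (e : E →L[ℝ] S), ‖(e.symm : S →L[ℝ] E)‖,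
    ContinuousLinearMap.opNorm_nonneg _, fun x => (e x : Y).2, fun x => ?_⟩
  have := (e.symm : S →L[ℝ] E).le_opNorm (e x)
  rw [ContinuousLinearEquiv.coe_coe, e.symm_apply_apply] at this
  exact this

theorem final_abstract (q : ℝ) (hq1 : 1 ≤ q) (hq : 2 < q)
    {F : ℕ → Type} [∀ n, NormedAddCommGroup (F n)] [∀ n, NormedSpace ℝ (F n)]
    (p : ℕ → ℝ) (hp0 : ∀ n, 0 < p n)
    (hL : ∀ n, LowerEst (p n) (F n)) (hU : ∀ n, UpperEst (p n) (F n))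
    (hne : ∀ n, q ≠ p n) (c0sum : Submodule ℝ (lp F ∞))
    (hc0 : ∀ f ∈ c0sum, Tendsto (fun n => ‖f n‖) atTop (nhds 0))
    (S : Submodule ℝ c0sum) (e : lpSeq q hq1 ≃L[ℝ] S) : False := by
  obtain ⟨J, D, hD, hJm, hlow⟩ := embed_bounds c0sum S e
  have hJ0 : ∀ x, Tendsto (fun n => ‖J x n‖) atTop (nhds 0) := fun x => hc0 _ (hJm x)
  let T : ∀ n, lpSeq q hq1 →ₗ[ℝ] F n := fun n =>
    (lp.evalₗ F ∞ n : lp F ∞ →ₗ[ℝ] F n).comp (J : lpSeq q hq1 →ₗ[ℝ] lp F ∞)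
  have hC : ∀ n x, ‖T n x‖ ≤ ‖J‖ * ‖x‖ := fun n x =>
    (lp.norm_apply_le_norm ENNReal.top_ne_zero (J x) n).trans (J.le_opNorm x)
  obtain ⟨K, hK⟩ := exists_nat_gt ((D * (‖J‖ + 1)) ^ q)
  obtain ⟨z, hz, hzT⟩ := main_lpSeq q hq1 hq T ‖J‖ (norm_nonneg _) hC p hp0 hL hU hne hJ0 K
  have hJz : ‖J z‖ ≤ ‖J‖ + 1 := lp.norm_le_of_forall_le (by positivity) hzT
  have h1 : ‖z‖ ≤ D * (‖J‖ + 1) :=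
    (hlow z).trans (mul_le_mul_of_nonneg_left hJz hD)
  have h2 := Real.rpow_le_rpow (norm_nonneg z) h1 (by linarith : 0 ≤ q)
  rw [hz] at h2
  linarith

/-- If `A = {p_n} ⊆ (2,3)` is countable and `q ∈ (2,3)`, `q ∉ A`, then `ℓ_q` is not
isomorphic to any closed subspace of the `c₀`-direct sum `(Σ_n ⊕ ℓ_{p_n})_{c₀}`
(realized as the submodule of the `ℓ_∞`-sum consisting of sequences whose component
norms tend to `0`). -/
theorem lq_not_isomorphic_to_subspace_of_c0_sum
    (p : ℕ → ℝ) (hp : ∀ n, p n ∈ Set.Ioo (2:ℝ) 3)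
    (q : ℝ) (hq : q ∈ Set.Ioo (2:ℝ) 3) (hqA : ∀ n, q ≠ p n)
    (c0sum : Submodule ℝ (lp (fun n => lpSeq (p n) (by linarith [(hp n).1])) ∞))
    (hc0 : (c0sum : Set (lp (fun n => lpSeq (p n) (by linarith [(hp n).1])) ∞)) =
      {f | Tendsto (fun n => ‖(f : ∀ n, lpSeq (p n) (by linarith [(hp n).1])) n‖)
        atTop (nhds 0)}) :
    ¬ ∃ (S : Submodule ℝ c0sum) (_ : IsClosed (S : Set c0sum)),
        Nonempty (lpSeq q (by linarith [hq.1]) ≃L[ℝ] S) := by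
  rintro ⟨S, -, ⟨e⟩⟩
  refine final_abstract q (by linarith [hq.1]) hq.1 p (fun n => by linarith [(hp n).1])
    (fun n => lowerEst_lpSeq (p n) (by linarith [(hp n).1]) (hp n).1.le)
    (fun n => upperEst_lpSeq (p n) (by linarith [(hp n).1])) hqA c0sum (fun f hf => ?_) S e
  have hf' := SetLike.mem_coe.2 hf
  rw [hc0] at hf'
  exact hf'
end
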